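/- arXiv:2410.10195 — 2 statements merged into one kernel-verified Lean document; each statement's English description precedes it below -/
import Mathlib

section
/- Let d ≥ 1, let Ω ⊂ ℝ^d be open and bounded, let ρ₁, ρ₂, ν₁, ν₂ > 0, λ, ε > 0, and let M : ℝ → ℝ be smooth. Let φ, μ, p : ℝ × ℝ^d → ℝ and u : ℝ × ℝ^d → ℝ^d be smooth, and suppose there is a compact set K contained in Ω such that for every t the spatial supports of φ(t,·), μ(t,·), p(t,·), u(t,·) are contained in K. Set ρ = ρ(φ), ν = ν(φ), J = M(φ)∇μ (ρ₂ − ρ₁)/2, and suppose that at every (t,x): ∂_t φ + ∇·(u φ) = ∇·(M(φ)∇μ); μ = λ(−ε Δφ + f(φ)/ε); ρ(∂_t u + (u·∇)u) + (J·∇)u − ∇·(ν D(u)) + ∇p + φ ∇μ = 0; and ∇·u = 0. Then the total energy E(t) = ∫_Ω ( (1/2) ρ |u|² + (λε/2)|∇φ|² + (λ/ε) F(φ) ) dx is differentiable in t with E′(t) = −∫_Ω M(φ)|∇μ|² dx − (1/2) ∫_Ω ν |D(u)|² dx; in particular, if M ≥ 0 and ν(φ(t,x)) ≥ 0 for all (t,x),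 then E is nonincreasing. -/
open MeasureTheory

noncomputable section

/-- Gradient of a scalar field on `ℝ^d`. -/
def grad {d : ℕ} (f : (Fin d → ℝ) → ℝ) (x : Fin d → ℝ) : Fin d → ℝ :=
  fun i => fderiv ℝ f x (Pi.single i 1)

/-- Divergence `∇·v` of a vector field on `ℝ^d`. -/
def vdiv {d : ℕ} (v : (Fin d → ℝ) → (Fin d → ℝ)) (x : Fin d → ℝ) : ℝ :=
  ∑ i, fderiv ℝ (fun y => v y i) x (Pi.single i 1)

/-- Euclidean inner product on `ℝ^d`. -/
def dot {d : ℕ} (v w : Fin d → ℝ) : ℝ := ∑ i, v i * w i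

/-- Directional derivative `((v·∇)w)(x)`: derivative of `w` at `x` in direction `v x`. -/
def dirD {d : ℕ} (v w : (Fin d → ℝ) → (Fin d → ℝ)) (x : Fin d → ℝ) : Fin d → ℝ :=
  fun i => fderiv ℝ (fun y => w y i) x (v x)

/-- Laplacian of a scalar field. -/
def lap {d : ℕ} (f : (Fin d → ℝ) → ℝ) (x : Fin d → ℝ) : ℝ := vdiv (grad f) x

/-- Strain tensor `D(u) = ∇u + ∇uᵀ`. -/
def strain {d : ℕ} (u : (Fin d → ℝ) → (Fin d → ℝ)) (x : Fin d → ℝ) (i j : Fin d) : ℝ :=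
  fderiv ℝ (fun y => u y i) x (Pi.single j 1) + fderiv ℝ (fun y => u y j) x (Pi.single i 1)

/-- Squared Frobenius norm `|D(u)|²` of the strain tensor. -/
def strainSq {d : ℕ} (u : (Fin d → ℝ) → (Fin d → ℝ)) (x : Fin d → ℝ) : ℝ :=
  ∑ i, ∑ j, (strain u x i j) ^ 2

/-- Row-wise divergence `∇·(ν D(u))`. -/
def divStrain {d : ℕ} (ν : (Fin d → ℝ) → ℝ) (u : (Fin d → ℝ) → (Fin d → ℝ))
    (x : Fin d → ℝ) : Fin d → ℝ :=
  fun i => ∑ j, fderiv ℝ (fun y => ν y * strain u y i j) x (Pi.single j 1)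

/-- Squared `L²(Ω)` norm of a scalar field. -/
def l2sq {d : ℕ} (Ω : Set (Fin d → ℝ)) (g : (Fin d → ℝ) → ℝ) : ℝ := ∫ x in Ω, (g x) ^ 2

/-- Squared `L²(Ω)` norm of a vector field. -/
def l2vsq {d : ℕ} (Ω : Set (Fin d → ℝ)) (v : (Fin d → ℝ) → (Fin d → ℝ)) : ℝ :=
  ∫ x in Ω, dot (v x) (v x)

/-- Joint smoothness of a time dependent scalar field. -/
def Sm {d : ℕ} (g : ℝ → (Fin d → ℝ) → ℝ) : Prop :=
  ContDiff ℝ (⊤ : ℕ∞) (fun q : ℝ × (Fin d → ℝ) => g q.1 q.2)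

lemma Sm.slice {d : ℕ} {g : ℝ → (Fin d → ℝ) → ℝ} (h : Sm g) (t : ℝ) :
    ContDiff ℝ (⊤ : ℕ∞) (g t) := by
  have h2 : ContDiff ℝ (⊤ : ℕ∞) (fun x : Fin d → ℝ => (t, x)) := by fun_prop
  exact ContDiff.comp (g := fun q : ℝ × (Fin d → ℝ) => g q.1 q.2) h h2

lemma Sm.hasFDerivAt {d : ℕ} {g : ℝ → (Fin d → ℝ) → ℝ} (h : Sm g) (q : ℝ × (Fin d → ℝ)) :
    HasFDerivAt (fun q : ℝ × (Fin d → ℝ) => g q.1 q.2)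
      (fderiv ℝ (fun q : ℝ × (Fin d → ℝ) => g q.1 q.2) q) q :=
  (ContDiff.differentiable h (by simp) q).hasFDerivAt

lemma Sm.fderiv_eq {d : ℕ} {g : ℝ → (Fin d → ℝ) → ℝ} (h : Sm g) (t : ℝ) (x v : Fin d → ℝ) :
    fderiv ℝ (g t) x v = fderiv ℝ (fun q : ℝ × (Fin d → ℝ) => g q.1 q.2) (t, x) (0, v) := by
  have h1 : HasFDerivAt (fun x : Fin d → ℝ => (t, x))
      (ContinuousLinearMap.inr ℝ ℝ (Fin d → ℝ)) x := hasFDerivAt_prodMk_right t x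
  have h2 := HasFDerivAt.comp (g := fun q : ℝ × (Fin d → ℝ) => g q.1 q.2) x
    (h.hasFDerivAt (t, x)) h1
  have h3 : fderiv ℝ (g t) x = _ := h2.fderiv
  rw [h3]; simp

lemma Sm.hasDerivAt {d : ℕ} {g : ℝ → (Fin d → ℝ) → ℝ} (h : Sm g) (t : ℝ) (x : Fin d → ℝ) :
    HasDerivAt (fun s => g s x)
      (fderiv ℝ (fun q : ℝ × (Fin d → ℝ) => g q.1 q.2) (t, x) (1, 0)) t := by
  have h1 : HasFDerivAt (fun s : ℝ => (s, x))
      (ContinuousLinearMap.inl ℝ ℝ (Fin d → ℝ)) t := hasFDerivAt_prodMk_left t x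
  have h2 := HasFDerivAt.comp (g := fun q : ℝ × (Fin d → ℝ) => g q.1 q.2) t
    (h.hasFDerivAt (t, x)) h1
  have h3 : HasDerivAt (fun s => g s x) _ t := h2.hasDerivAt
  convert h3 using 1
  simp

lemma Sm.hasDerivAt' {d : ℕ} {g : ℝ → (Fin d → ℝ) → ℝ} (h : Sm g) (t : ℝ) (x : Fin d → ℝ) :
    HasDerivAt (fun s => g s x) (deriv (fun s => g s x) t) t :=
  (h.hasDerivAt t x).differentiableAt.hasDerivAt

lemma Sm.full {d : ℕ} {g : ℝ → (Fin d → ℝ) → ℝ} (h : Sm g) (w : ℝ × (Fin d → ℝ)) :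
    ContDiff ℝ (⊤ : ℕ∞) (fun q => fderiv ℝ (fun q : ℝ × (Fin d → ℝ) => g q.1 q.2) q w) :=
  (ContDiff.fderiv_right (m := (⊤ : ℕ∞)) h (by simp)).clm_apply contDiff_const

lemma Sm.space {d : ℕ} {g : ℝ → (Fin d → ℝ) → ℝ} (h : Sm g) (v : Fin d → ℝ) :
    Sm (fun t x => fderiv ℝ (g t) x v) := by
  unfold Sm
  simp only [h.fderiv_eq]
  exact h.full (0, v)

lemma Sm.time {d : ℕ} {g : ℝ → (Fin d → ℝ) → ℝ} (h : Sm g) :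
    Sm (fun t x => deriv (fun s => g s x) t) := by
  have : (fun t x => deriv (fun s => g s x) t) = fun t x =>
      fderiv ℝ (fun q : ℝ × (Fin d → ℝ) => g q.1 q.2) (t, x) (1, 0) := by
    funext t x; exact (h.hasDerivAt t x).deriv
  rw [this]
  exact h.full (1, 0)

lemma Sm.comm {d : ℕ} {g : ℝ → (Fin d → ℝ) → ℝ} (h : Sm g) (t : ℝ) (x v : Fin d → ℝ) :
    deriv (fun s => fderiv ℝ (g s) x v) t =
      fderiv ℝ (fun y => deriv (fun s => g s y) t) x v := by
  rw [((h.space v).hasDerivAt t x).deriv, h.time.fderiv_eq t x v]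
  have e1 : (fun q : ℝ × (Fin d → ℝ) => fderiv ℝ (g q.1) q.2 v) =
      fun q => fderiv ℝ (fun q : ℝ × (Fin d → ℝ) => g q.1 q.2) q (0, v) := by
    funext q; exact h.fderiv_eq _ _ _
  have e2 : (fun q : ℝ × (Fin d → ℝ) => deriv (fun s => g s q.2) q.1) =
      fun q => fderiv ℝ (fun q : ℝ × (Fin d → ℝ) => g q.1 q.2) q (1, 0) := by
    funext q; exact (h.hasDerivAt _ _).deriv
  rw [e1, e2]
  have hd : DifferentiableAt ℝ (fderiv ℝ (fun q : ℝ × (Fin d → ℝ) => g q.1 q.2)) (t, x) :=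
    (ContDiff.fderiv_right (m := (⊤ : ℕ∞)) h (by simp)).differentiable (by simp) _
  have hs : IsSymmSndFDerivAt ℝ (fun q : ℝ × (Fin d → ℝ) => g q.1 q.2) (t, x) :=
    ContDiffAt.isSymmSndFDerivAt (n := ((⊤ : ℕ∞) : WithTop ℕ∞)) (ContDiff.contDiffAt h)
      (by simp only [minSmoothness_of_isRCLikeNormedField]; exact WithTop.coe_le_coe.2 le_top)
  rw [fderiv_clm_apply hd (by fun_prop), fderiv_clm_apply hd (by fun_prop)]
  simpa using hs.eq (1, 0) (0, v)

lemma integrableOn_of_cont {d : ℕ} {Ω : Set (Fin d → ℝ)} (hΩb : Bornology.IsBounded Ω)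
    {f : (Fin d → ℝ) → ℝ} (hf : Continuous f) : IntegrableOn f Ω :=
  (hf.continuousOn.integrableOn_compact hΩb.isCompact_closure).mono_set subset_closure

lemma Sm.hasDerivAt_integral {d : ℕ} {Ω : Set (Fin d → ℝ)} (hΩo : IsOpen Ω)
    (hΩb : Bornology.IsBounded Ω) {g : ℝ → (Fin d → ℝ) → ℝ} (h : Sm g) (t : ℝ) :
    HasDerivAt (fun s => ∫ x in Ω, g s x) (∫ x in Ω, deriv (fun s => g s x) t) t := by
  have hc : Continuous (fun q : ℝ × (Fin d → ℝ) => deriv (fun s => g s q.2) q.1) :=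
    ContDiff.continuous h.time
  obtain ⟨C, hC⟩ := ((isCompact_closedBall t 1).prod
    hΩb.isCompact_closure).exists_bound_of_continuousOn hc.continuousOn
  refine (hasDerivAt_integral_of_dominated_loc_of_deriv_le
    (F' := fun s x => deriv (fun s => g s x) s) (bound := fun _ => C)
    (Metric.closedBall_mem_nhds t one_pos) ?_ ?_ ?_ ?_ ?_ ?_).2
  · exact Filter.Eventually.of_forall fun s => (h.slice s).continuous.aestronglyMeasurable
  · exact integrableOn_of_cont hΩb (h.slice t).continuous
  · exact (h.time.slice t).continuous.aestronglyMeasurable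
  · filter_upwards [ae_restrict_mem hΩo.measurableSet] with x hx s hs
    exact hC (s, x) ⟨hs, subset_closure hx⟩
  · exact integrableOn_of_cont hΩb continuous_const
  · exact Filter.Eventually.of_forall fun x s _ => h.hasDerivAt' s x

/-- Integrable with vanishing integral. -/
def Nul {d : ℕ} (Ω : Set (Fin d → ℝ)) (f : (Fin d → ℝ) → ℝ) : Prop :=
  IntegrableOn f Ω ∧ ∫ x in Ω, f x = 0

lemma Nul.add {d : ℕ} {Ω : Set (Fin d → ℝ)} {f g : (Fin d → ℝ) → ℝ} (hf : Nul Ω f)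
    (hg : Nul Ω g) : Nul Ω (fun x => f x + g x) :=
  ⟨hf.1.add hg.1, by rw [integral_add hf.1 hg.1, hf.2, hg.2, add_zero]⟩

lemma Nul.smul {d : ℕ} {Ω : Set (Fin d → ℝ)} {f : (Fin d → ℝ) → ℝ} (c : ℝ) (hf : Nul Ω f) :
    Nul Ω (fun x => c * f x) :=
  ⟨hf.1.const_mul c, by rw [integral_const_mul, hf.2, mul_zero]⟩

lemma Nul.sum {d : ℕ} {Ω : Set (Fin d → ℝ)} {f : Fin d → (Fin d → ℝ) → ℝ}
    (hf : ∀ i, Nul Ω (f i)) : Nul Ω (fun x => ∑ i, f i x) :=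
  ⟨integrable_finsetSum _ fun i _ => (hf i).1, by
    rw [integral_finsetSum _ fun i _ => (hf i).1]; simp [(hf _).2]⟩

lemma nul_vdiv {d : ℕ} {Ω Kc : Set (Fin d → ℝ)} (hKc : IsCompact Kc) (hKΩ : Kc ⊆ Ω)
    {a : (Fin d → ℝ) → ℝ} {v : (Fin d → ℝ) → (Fin d → ℝ)} (ha : ContDiff ℝ 1 a)
    (hv : ∀ i, ContDiff ℝ 1 (fun y => v y i)) (h0 : ∀ x, x ∉ Kc → a x = 0) :
    Nul Ω (vdiv (fun y i => a y * v y i)) := by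
  unfold vdiv
  refine Nul.sum fun i => ?_
  have hg : ContDiff ℝ 1 (fun y => a y * v y i) := ha.mul (hv i)
  have hg0 : ∀ x, x ∉ Kc → a x * v x i = 0 := fun x hx => by rw [h0 x hx, zero_mul]
  have hcs : HasCompactSupport (fun y => a y * v y i) := HasCompactSupport.intro hKc hg0
  have hcs' := hcs.fderiv_apply (𝕜 := ℝ) (Pi.single i 1)
  have hc' : Continuous (fun x => fderiv ℝ (fun y => a y * v y i) x (Pi.single i 1)) :=
    (hg.continuous_fderiv (by simp)).clm_apply continuous_const
  have hInteg := hc'.integrable_of_hasCompactSupport (μ := volume) hcs'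
  have hts : tsupport (fun y => a y * v y i) ⊆ Kc :=
    closure_minimal (fun x hx => by by_contra h; exact hx (hg0 x h)) hKc.isClosed
  refine ⟨hInteg.integrableOn, ?_⟩
  rw [setIntegral_eq_integral_of_forall_compl_eq_zero]
  · have := integral_mul_fderiv_eq_neg_fderiv_mul_of_integrable (μ := volume)
      (f := fun _ : Fin d → ℝ => (1 : ℝ)) (g := fun y => a y * v y i) (v := Pi.single i 1)
      (by simp) (by simpa using hInteg)
      (by simpa using hg.continuous.integrable_of_hasCompactSupport hcs)
      (fun _ _ => by fun_prop) (fun x _ => hg.differentiable (by simp) x)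
    simpa using this
  · intro x hx
    have : x ∉ tsupport (fun y => a y * v y i) := fun h => hx (hKΩ (hts h))
    rw [image_eq_zero_of_notMem_tsupport
      (fun h => this (tsupport_fderiv_subset ℝ h))]
    rfl

lemma vdiv_mul {d : ℕ} {a : (Fin d → ℝ) → ℝ} {v : (Fin d → ℝ) → (Fin d → ℝ)}
    (ha : ContDiff ℝ 1 a) (hv : ∀ i, ContDiff ℝ 1 (fun y => v y i)) (x : Fin d → ℝ) :
    vdiv (fun y i => a y * v y i) x = dot (grad a x) (v x) + a x * vdiv v x := by
  unfold vdiv dot grad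
  rw [Finset.mul_sum, ← Finset.sum_add_distrib]
  refine Finset.sum_congr rfl fun i _ => ?_
  rw [fderiv_fun_mul (ha.differentiable (by simp) x) ((hv i).differentiable (by simp) x)]
  simp only [add_apply, smul_apply, smul_eq_mul]
  ring

lemma fderiv_eq_sum {d : ℕ} (f : (Fin d → ℝ) → ℝ) (x w : Fin d → ℝ) :
    fderiv ℝ f x w = ∑ j, w j * fderiv ℝ f x (Pi.single j 1) := by
  conv_lhs => rw [pi_eq_sum_univ' w]
  simp

lemma mom_sum {d : ℕ} {r m k f : ℝ} {U T gmu gp N : Fin d → ℝ} {A : Fin d → Fin d → ℝ}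
    (h : ∀ i, r * (T i + ∑ j, U j * A i j) + ∑ j, (m * gmu j * k) * A i j - N i + gp i
      + f * gmu i = 0) :
    r * (∑ i, U i * T i) + r * (∑ i, U i * ∑ j, U j * A i j)
      + m * k * (∑ i, U i * ∑ j, gmu j * A i j) - (∑ i, U i * N i) + (∑ i, gp i * U i)
      + f * (∑ i, gmu i * U i) = 0 := by
  have h1 : ∑ i, U i * (r * (T i + ∑ j, U j * A i j) + ∑ j, (m * gmu j * k) * A i j - N i + gp i
      + f * gmu i) = 0 := Finset.sum_eq_zero fun i _ => by rw [h i, mul_zero]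
  rw [← h1]
  rw [Finset.mul_sum, Finset.mul_sum (f := fun i => U i * ∑ j, U j * A i j),
    Finset.mul_sum (f := fun i => U i * ∑ j, gmu j * A i j),
    Finset.mul_sum (f := fun i => gmu i * U i),
    ← Finset.sum_add_distrib, ← Finset.sum_add_distrib, ← Finset.sum_sub_distrib,
    ← Finset.sum_add_distrib, ← Finset.sum_add_distrib]
  refine Finset.sum_congr rfl fun i _ => ?_
  have : ∑ j, (m * gmu j * k) * A i j = m * k * ∑ j, gmu j * A i j := by
    rw [Finset.mul_sum]; exact Finset.sum_congr rfl fun j _ => by ring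
  rw [this]; ring

lemma strain_sum {d : ℕ} (A : Fin d → Fin d → ℝ) :
    ∑ i, ∑ j, A i j * (A i j + A j i) = (1 / 2) * ∑ i, ∑ j, (A i j + A j i) ^ 2 := by
  have h1 : ∑ i, ∑ j, A i j * (A i j + A j i) = ∑ i, ∑ j, A j i * (A j i + A i j) :=
    Finset.sum_comm
  have h2 : ∑ i, ∑ j, (A i j + A j i) ^ 2 =
      ∑ i, ∑ j, A i j * (A i j + A j i) + ∑ i, ∑ j, A j i * (A j i + A i j) := by
    rw [← Finset.sum_add_distrib]
    refine Finset.sum_congr rfl fun i _ => ?_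
    rw [← Finset.sum_add_distrib]
    exact Finset.sum_congr rfl fun j _ => by ring
  rw [h2, ← h1]; ring

lemma dot_grad_q {d : ℕ} {v : (Fin d → ℝ) → (Fin d → ℝ)}
    (hv : ∀ i, ContDiff ℝ 1 (fun y => v y i)) (x V : Fin d → ℝ) :
    dot (grad (fun y => ∑ i, (1 / 2) * (v y i * v y i)) x) V =
      ∑ i, v x i * ∑ j, V j * fderiv ℝ (fun y => v y i) x (Pi.single j 1) := by
  have hd : ∀ i, DifferentiableAt ℝ (fun y => v y i) x := fun i =>
    (hv i).differentiable (by simp) x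
  have hg : ∀ j, grad (fun y => ∑ i, (1 / 2) * (v y i * v y i)) x j =
      ∑ i, v x i * fderiv ℝ (fun y => v y i) x (Pi.single j 1) := by
    intro j
    unfold grad
    rw [fderiv_fun_sum (fun i _ => ((hd i).fun_mul (hd i)).const_mul _)]
    rw [sum_apply]
    refine Finset.sum_congr rfl fun i _ => ?_
    rw [fderiv_const_mul ((hd i).fun_mul (hd i)), fderiv_fun_mul (hd i) (hd i)]
    simp only [add_apply, smul_apply, smul_eq_mul]
    ring
  unfold dot
  simp only [hg, Finset.sum_mul, Finset.mul_sum]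
  rw [Finset.sum_comm]
  exact Finset.sum_congr rfl fun i _ => Finset.sum_congr rfl fun j _ => by ring

lemma hasDerivAt_dot {d : ℕ} {a : ℝ → Fin d → ℝ} {a' : Fin d → ℝ} {t : ℝ}
    (h : ∀ i, HasDerivAt (fun s => a s i) (a' i) t) :
    HasDerivAt (fun s => dot (a s) (a s)) (2 * ∑ i, a t i * a' i) t := by
  unfold dot
  rw [Finset.mul_sum]
  have := HasDerivAt.fun_sum (u := Finset.univ) (A := fun i s => a s i * a s i)
    (fun i _ => (h i).fun_mul (h i))
  refine this.congr_deriv (Finset.sum_congr rfl fun i _ => by ring)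

lemma Nul.combine {d : ℕ} {Ω : Set (Fin d → ℝ)} {e f g Z : (Fin d → ℝ) → ℝ}
    (hf : IntegrableOn f Ω) (hg : IntegrableOn g Ω) (hZ : Nul Ω Z)
    (h : ∀ x, e x = -f x - (1 / 2) * g x + Z x) :
    ∫ x in Ω, e x = -(∫ x in Ω, f x) - (1 / 2) * ∫ x in Ω, g x := by
  have h1 : IntegrableOn (fun x => -f x) Ω := hf.neg
  have h2 : IntegrableOn (fun x => (1 / 2) * g x) Ω := hg.const_mul _
  have h3 : IntegrableOn (fun x => -f x - (1 / 2) * g x) Ω := h1.sub h2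
  simp only [h]
  rw [integral_add h3 hZ.1, integral_sub h1 h2, integral_neg, integral_const_mul, hZ.2, add_zero]

theorem stmt4 {d : ℕ} (hd : 1 ≤ d) (Ω : Set (Fin d → ℝ)) (hΩo : IsOpen Ω)
    (hΩb : Bornology.IsBounded Ω)
    (ρ₁ ρ₂ ν₁ ν₂ lam ε : ℝ)
    (hρ₁ : 0 < ρ₁) (hρ₂ : 0 < ρ₂) (hν₁ : 0 < ν₁) (hν₂ : 0 < ν₂)
    (hlam : 0 < lam) (hε : 0 < ε)
    (M : ℝ → ℝ) (hM : ContDiff ℝ (⊤ : ℕ∞) M)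
    (φ μ p : ℝ → (Fin d → ℝ) → ℝ) (u : ℝ → (Fin d → ℝ) → (Fin d → ℝ))
    (hφ : ContDiff ℝ (⊤ : ℕ∞) (fun q : ℝ × (Fin d → ℝ) => φ q.1 q.2))
    (hμ : ContDiff ℝ (⊤ : ℕ∞) (fun q : ℝ × (Fin d → ℝ) => μ q.1 q.2))
    (hp : ContDiff ℝ (⊤ : ℕ∞) (fun q : ℝ × (Fin d → ℝ) => p q.1 q.2))
    (hu : ContDiff ℝ (⊤ : ℕ∞) (fun q : ℝ × (Fin d → ℝ) => u q.1 q.2))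
    (Kc : Set (Fin d → ℝ)) (hKc : IsCompact Kc) (hKΩ : Kc ⊆ Ω)
    (hφsupp : ∀ t, tsupport (φ t) ⊆ Kc) (hμsupp : ∀ t, tsupport (μ t) ⊆ Kc)
    (hpsupp : ∀ t, tsupport (p t) ⊆ Kc) (husupp : ∀ t, tsupport (u t) ⊆ Kc)
    (hCH : ∀ t x, deriv (fun s => φ s x) t + vdiv (fun y i => φ t y * u t y i) x =
      vdiv (fun y i => M (φ t y) * grad (μ t) y i) x)
    (hchem : ∀ t x, μ t x = lam * (-(ε * lap (φ t) x) + ((φ t x) ^ 3 - φ t x) / ε))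
    (hmom : ∀ t x (i : Fin d),
      ((φ t x) / 2 * (ρ₁ - ρ₂) + (ρ₁ + ρ₂) / 2) *
          (deriv (fun s => u s x i) t + dirD (u t) (u t) x i) +
        dirD (fun y j => M (φ t y) * grad (μ t) y j * ((ρ₂ - ρ₁) / 2)) (u t) x i -
        divStrain (fun y => (φ t y) / 2 * (ν₁ - ν₂) + (ν₁ + ν₂) / 2) (u t) x i +
        grad (p t) x i + φ t x * grad (μ t) x i = 0)
    (hdivfree : ∀ t x, vdiv (u t) x = 0) :
    (∀ t, HasDerivAt
      (fun s => ∫ x in Ω,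
        ((1 / 2) * ((φ s x) / 2 * (ρ₁ - ρ₂) + (ρ₁ + ρ₂) / 2) * dot (u s x) (u s x) +
          lam * ε / 2 * dot (grad (φ s) x) (grad (φ s) x) +
          lam / ε * ((1 / 4) * ((φ s x) ^ 2 - 1) ^ 2)))
      (-(∫ x in Ω, M (φ t x) * dot (grad (μ t) x) (grad (μ t) x)) -
        (1 / 2) * ∫ x in Ω, ((φ t x) / 2 * (ν₁ - ν₂) + (ν₁ + ν₂) / 2) * strainSq (u t) x) t) ∧
    ((∀ z, 0 ≤ M z) → (∀ t x, 0 ≤ (φ t x) / 2 * (ν₁ - ν₂) + (ν₁ + ν₂) / 2) →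
      Antitone (fun s => ∫ x in Ω,
        ((1 / 2) * ((φ s x) / 2 * (ρ₁ - ρ₂) + (ρ₁ + ρ₂) / 2) * dot (u s x) (u s x) +
          lam * ε / 2 * dot (grad (φ s) x) (grad (φ s) x) +
          lam / ε * ((1 / 4) * ((φ s x) ^ 2 - 1) ^ 2)))) := by
  have hui : ∀ i, Sm (fun t x => u t x i) := fun i => contDiff_pi.1 hu i
  have hφS : Sm φ := hφ
  have hμS : Sm μ := hμ
  have hpS : Sm p := hp
  have hgφ : ∀ i, Sm (fun t x => grad (φ t) x i) := fun i => hφS.space _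
  have hgμ : ∀ i, Sm (fun t x => grad (μ t) x i) := fun i => hμS.space _
  have hdot : ∀ {v : ℝ → (Fin d → ℝ) → (Fin d → ℝ)}, (∀ i, Sm (fun t x => v t x i)) →
      Sm (fun t x => dot (v t x) (v t x)) := by
    intro v hv
    exact ContDiff.sum fun i _ => (hv i).mul (hv i)
  have hdu := hdot hui
  have hdg := hdot hgφ
  have hdm := hdot hgμ
  have hMφ : Sm (fun t x => M (φ t x)) := ContDiff.comp hM hφ
  have hνS : Sm (fun t x => (φ t x) / 2 * (ν₁ - ν₂) + (ν₁ + ν₂) / 2) := by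
    unfold Sm; fun_prop
  have hst : ∀ i j, Sm (fun t x => strain (u t) x i j) := fun i j =>
    ContDiff.add ((hui i).space _) ((hui j).space _)
  have hsq : Sm (fun t x => strainSq (u t) x) :=
    ContDiff.sum fun i _ => ContDiff.sum fun j _ => ContDiff.pow (hst i j) 2
  have hE : Sm (fun s x =>
        ((1 / 2) * ((φ s x) / 2 * (ρ₁ - ρ₂) + (ρ₁ + ρ₂) / 2) * dot (u s x) (u s x) +
          lam * ε / 2 * dot (grad (φ s) x) (grad (φ s) x) +
          lam / ε * ((1 / 4) * ((φ s x) ^ 2 - 1) ^ 2))) := by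
    unfold Sm at hdu hdg ⊢
    fun_prop
  have hder : ∀ t, HasDerivAt
      (fun s => ∫ x in Ω,
        ((1 / 2) * ((φ s x) / 2 * (ρ₁ - ρ₂) + (ρ₁ + ρ₂) / 2) * dot (u s x) (u s x) +
          lam * ε / 2 * dot (grad (φ s) x) (grad (φ s) x) +
          lam / ε * ((1 / 4) * ((φ s x) ^ 2 - 1) ^ 2)))
      (-(∫ x in Ω, M (φ t x) * dot (grad (μ t) x) (grad (μ t) x)) -
        (1 / 2) * ∫ x in Ω, ((φ t x) / 2 * (ν₁ - ν₂) + (ν₁ + ν₂) / 2) * strainSq (u t) x) t := by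
    intro t
    refine (hE.hasDerivAt_integral hΩo hΩb t).congr_deriv ?_
    have c1 : ∀ {g : ℝ → (Fin d → ℝ) → ℝ}, Sm g → ContDiff ℝ 1 (g t) := fun h =>
      (h.slice t).of_le (by exact_mod_cast le_top)
    -- vanishing outside the compact set
    have zφ : ∀ s x, x ∉ Kc → φ s x = 0 := fun s x hx =>
      image_eq_zero_of_notMem_tsupport fun h => hx (hφsupp s h)
    have zμ : ∀ x, x ∉ Kc → μ t x = 0 := fun x hx =>
      image_eq_zero_of_notMem_tsupport fun h => hx (hμsupp t h)
    have zp : ∀ x, x ∉ Kc → p t x = 0 := fun x hx =>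
      image_eq_zero_of_notMem_tsupport fun h => hx (hpsupp t h)
    have zu : ∀ x, x ∉ Kc → u t x = 0 := fun x hx =>
      image_eq_zero_of_notMem_tsupport fun h => hx (husupp t h)
    have zφt : ∀ x, x ∉ Kc → deriv (fun s => φ s x) t = 0 := fun x hx => by
      simp [zφ _ x hx]
    have zq : ∀ x, x ∉ Kc → ∑ i, (1 / 2) * (u t x i * u t x i) = 0 := fun x hx => by
      simp [zu x hx]
    -- regularity
    have cu : ∀ i, ContDiff ℝ 1 (fun y => u t y i) := fun i => c1 (hui i)
    have cφ : ContDiff ℝ 1 (φ t) := c1 hφS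
    have cμ : ContDiff ℝ 1 (μ t) := c1 hμS
    have cp : ContDiff ℝ 1 (p t) := c1 hpS
    have cφt : ContDiff ℝ 1 (fun y => deriv (fun s => φ s y) t) := c1 hφS.time
    have cgφ : ∀ i, ContDiff ℝ 1 (fun y => grad (φ t) y i) := fun i => c1 (hgφ i)
    have cV1 : ∀ i, ContDiff ℝ 1 (fun y => φ t y * u t y i) := fun i => cφ.mul (cu i)
    have cV3 : ∀ i, ContDiff ℝ 1 (fun y => M (φ t y) * grad (μ t) y i) := fun i =>
      (c1 hMφ).mul (c1 (hgμ i))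
    have cq : ContDiff ℝ 1 (fun y => ∑ i, (1 / 2) * (u t y i * u t y i)) :=
      ContDiff.sum fun i _ => contDiff_const.mul ((cu i).mul (cu i))
    have cS : ∀ i j, ContDiff ℝ 1 (fun y =>
        ((φ t y) / 2 * (ν₁ - ν₂) + (ν₁ + ν₂) / 2) * strain (u t) y i j) := fun i j =>
      (c1 hνS).mul (c1 (hst i j))
    -- null terms
    have n1 := (nul_vdiv hKc hKΩ cφt cgφ zφt).smul (lam * ε)
    have n2 := (nul_vdiv hKc hKΩ cq cV1 zq).smul (-((ρ₁ - ρ₂) / 2))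
    have n3 := (nul_vdiv hKc hKΩ cq cu zq).smul (-((ρ₁ + ρ₂) / 2))
    have n4 := (nul_vdiv hKc hKΩ cq cV3 zq).smul ((ρ₁ - ρ₂) / 2)
    have n5 := Nul.sum fun i => nul_vdiv hKc hKΩ (cu i) (v := fun y j =>
        ((φ t y) / 2 * (ν₁ - ν₂) + (ν₁ + ν₂) / 2) * strain (u t) y i j) (cS i)
        (fun x hx => by simp [zu x hx])
    have n6 := (nul_vdiv hKc hKΩ cp cu zp).smul (-1)
    have n7 := (nul_vdiv hKc hKΩ cμ cV1 zμ).smul (-1)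
    have n8 := nul_vdiv hKc hKΩ cμ cV3 zμ
    have nZ := ((((((n1.add n2).add n3).add n4).add n5).add n6).add n7).add n8
    have i1 : IntegrableOn (fun x => M (φ t x) * dot (grad (μ t) x) (grad (μ t) x)) Ω :=
      integrableOn_of_cont hΩb ((c1 hMφ).continuous.mul (c1 hdm).continuous)
    have i2 : IntegrableOn (fun x => ((φ t x) / 2 * (ν₁ - ν₂) + (ν₁ + ν₂) / 2)
        * strainSq (u t) x) Ω :=
      integrableOn_of_cont hΩb ((c1 hνS).continuous.mul (c1 hsq).continuous)
    refine Nul.combine i1 i2 nZ fun x => ?_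
    -- the time derivative of the energy density
    have hdφ := hφS.hasDerivAt' t x
    have e1 := hasDerivAt_dot (a := fun s => u s x) (fun i => (hui i).hasDerivAt' t x)
    have e2 := hasDerivAt_dot (a := fun s => grad (φ s) x) (fun i => (hgφ i).hasDerivAt' t x)
    have e3 := (((((hdφ.div_const 2).mul_const (ρ₁ - ρ₂)).add_const ((ρ₁ + ρ₂) / 2)).const_mul
      (1 / 2)).fun_mul e1).fun_add (e2.const_mul (lam * ε / 2)) |>.fun_add
      ((((hdφ.fun_pow 2).sub_const 1).fun_pow 2).const_mul (1 / 4) |>.const_mul (lam / ε))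
    rw [e3.deriv]
    have hcomm : ∀ i, deriv (fun s => grad (φ s) x i) t =
        grad (fun y => deriv (fun s => φ s y) t) x i := fun i => hφS.comm t x _
    simp only [hcomm]
    -- the divergence terms
    have hm := mom_sum (r := (φ t x) / 2 * (ρ₁ - ρ₂) + (ρ₁ + ρ₂) / 2) (m := M (φ t x))
      (k := (ρ₂ - ρ₁) / 2) (f := φ t x) (U := u t x)
      (T := fun i => deriv (fun s => u s x i) t) (gmu := grad (μ t) x) (gp := grad (p t) x)
      (N := divStrain (fun y => (φ t y) / 2 * (ν₁ - ν₂) + (ν₁ + ν₂) / 2) (u t) x)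
      (A := fun i j => fderiv ℝ (fun y => u t y i) x (Pi.single j 1))
      (fun i => by
        have := hmom t x i
        simp only [dirD] at this
        rw [fderiv_eq_sum _ _ (u t x), fderiv_eq_sum _ _ (fun j => _)] at this
        exact this)
    have h5 : ∑ i, vdiv (fun y j => u t y i *
        (((φ t y) / 2 * (ν₁ - ν₂) + (ν₁ + ν₂) / 2) * strain (u t) y i j)) x =
        (1 / 2) * (((φ t x) / 2 * (ν₁ - ν₂) + (ν₁ + ν₂) / 2) * strainSq (u t) x) +
        ∑ i, u t x i * divStrain (fun y => (φ t y) / 2 * (ν₁ - ν₂) + (ν₁ + ν₂) / 2) (u t) x i := by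
      have hs := strain_sum (fun i j => fderiv ℝ (fun y => u t y i) x (Pi.single j 1))
      have hs' : strainSq (u t) x = 2 * ∑ i, ∑ j,
          fderiv ℝ (fun y => u t y i) x (Pi.single j 1) * strain (u t) x i j := by
        unfold strainSq strain
        linarith
      rw [hs', mul_left_comm _ (2 : ℝ), ← mul_assoc, Finset.mul_sum]
      norm_num only [one_mul]
      rw [← Finset.sum_add_distrib]
      refine Finset.sum_congr rfl fun i _ => ?_
      rw [vdiv_mul (cu i) (v := fun y j =>
        ((φ t y) / 2 * (ν₁ - ν₂) + (ν₁ + ν₂) / 2) * strain (u t) y i j) (cS i)]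
      congr 1
      unfold dot grad
      rw [Finset.mul_sum]
      exact Finset.sum_congr rfl fun j _ => by ring
    rw [h5, vdiv_mul cφt cgφ, vdiv_mul cq cV1, vdiv_mul cq cu, vdiv_mul cq cV3, vdiv_mul cp cu,
      vdiv_mul cμ cV1, vdiv_mul cμ cV3, dot_grad_q cu, dot_grad_q cu, dot_grad_q cu]
    have s1 : ∑ i, u t x i * ∑ j, φ t x * u t x j * fderiv ℝ (fun y => u t y i) x (Pi.single j 1)
        = φ t x * ∑ i, u t x i * ∑ j, u t x j * fderiv ℝ (fun y => u t y i) x (Pi.single j 1) := by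
      simp only [Finset.mul_sum]
      exact Finset.sum_congr rfl fun i _ => Finset.sum_congr rfl fun j _ => by ring
    have s3 : ∑ i, u t x i * ∑ j, M (φ t x) * grad (μ t) x j *
          fderiv ℝ (fun y => u t y i) x (Pi.single j 1)
        = M (φ t x) * ∑ i, u t x i * ∑ j, grad (μ t) x j *
          fderiv ℝ (fun y => u t y i) x (Pi.single j 1) := by
      simp only [Finset.mul_sum]
      exact Finset.sum_congr rfl fun i _ => Finset.sum_congr rfl fun j _ => by ring
    have s7 : dot (grad (μ t) x) (fun i => φ t x * u t x i) =
        φ t x * ∑ i, grad (μ t) x i * u t x i := by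
      unfold dot
      rw [Finset.mul_sum]
      exact Finset.sum_congr rfl fun i _ => by ring
    have s8 : dot (grad (μ t) x) (fun i => M (φ t x) * grad (μ t) x i) =
        M (φ t x) * dot (grad (μ t) x) (grad (μ t) x) := by
      unfold dot
      rw [Finset.mul_sum]
      exact Finset.sum_congr rfl fun i _ => by ring
    have s2 : dot (u t x) (u t x) = 2 * ∑ i, (1 / 2) * (u t x i * u t x i) := by
      unfold dot
      rw [Finset.mul_sum]
      exact Finset.sum_congr rfl fun i _ => by ring
    have s4 : ∑ i, grad (φ t) x i * grad (fun y => deriv (fun s => φ s y) t) x i =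
        dot (grad (fun y => deriv (fun s => φ s y) t) x) (grad (φ t) x) := by
      unfold dot
      exact Finset.sum_congr rfl fun i _ => by ring
    have s6 : dot (grad (p t) x) (u t x) = ∑ i, grad (p t) x i * u t x i := rfl
    have hl : vdiv (grad (φ t)) x = lap (φ t) x := rfl
    have hc := hchem t x
    have hch := hCH t x
    have hW1 : vdiv (fun y i => φ t y * u t y i) x =
      vdiv (fun y i => M (φ t y) * grad (μ t) y i) x - deriv (fun s => φ s x) t := by linarith
    have hf : lam / ε * ((φ t x) ^ 3 - φ t x) = μ t x + lam * ε * lap (φ t) x := by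
      rw [hc]; ring
    rw [s1, s3, s7, s8, s2, s4, s6, hl, hdivfree t x, hW1]
    simp only [Nat.cast_ofNat, Nat.add_one_sub_one, pow_one]
    generalize (∑ i, (1 / 2) * (u t x i * u t x i)) = q at *
    linear_combination hm + deriv (fun s => φ s x) t * hf
  refine ⟨hder, fun hM0 hν0 => ?_⟩
  refine antitone_of_deriv_nonpos (fun t => (hder t).differentiableAt) fun t => ?_
  rw [(hder t).deriv]
  have p1 : 0 ≤ ∫ x in Ω, M (φ t x) * dot (grad (μ t) x) (grad (μ t) x) :=
    integral_nonneg fun x => mul_nonneg (hM0 _)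
      (Finset.sum_nonneg fun i _ => mul_self_nonneg _)
  have p2 : 0 ≤ ∫ x in Ω, ((φ t x) / 2 * (ν₁ - ν₂) + (ν₁ + ν₂) / 2) * strainSq (u t) x :=
    integral_nonneg fun x => mul_nonneg (hν0 t x)
      (Finset.sum_nonneg fun i _ => Finset.sum_nonneg fun j _ => sq_nonneg _)
  linarith
end
end

section
/- Let d ≥ 1, Ω ⊂ ℝ^d open and bounded, ρ₁, ρ₂, ν₁, ν₂ > 0, λ, ε, α > 0, s, β, χ ∈ ℝ, and M : ℝ → ℝ smooth. Let φ, μ, p : ℝ × ℝ^d → ℝ, u : ℝ × ℝ^d → ℝ^d be smooth with, for every t, spatial supports of φ(t,·), μ(t,·), p(t,·), u(t,·) contained in a fixed compact subset of Ω, and let r, Q, R, T, K : ℝ → ℝ be differentiable. Set ρ = ρ(φ), ν = ν(φ), J = M(φ)∇μ (ρ₂ − ρ₁)/2, E₀(t) = (λ/ε)∫_Ω (F(φ) − (s/2)φ²) dx. Suppose at every (t,x): ∂_t φ + Q ∇·(u φ) = ∇·(M(φ)∇μ); μ = λ(−ε Δφ + (s/ε)φ + (r/ε)(f(φ) − sφ));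 K(ρ ∂_t u + (1/2) ∂_t ρ u) − ∇·(ν D(u)) + R∇p + Q φ∇μ + R ρ (u·∇)u + (1/2) R ∇·(ρ u) u + R (J·∇)u + (1/2) R (∇·J) u = 0; ∇·u = 0; and the ODEs: r′ = α(−E₀′ + (rλ/ε)∫_Ω (f(φ) − sφ) ∂_t φ dx); Q′ = α Q ∫_Ω (∇·(u φ) μ + φ ⟨∇μ, u⟩) dx; R′ = α R ∫_Ω (ρ⟨(u·∇)u, u⟩ + (1/2)∇·(ρu)|u|² + ⟨(J·∇)u, u⟩ + (1/2)(∇·J)|u|² + ⟨∇p, u⟩) dx; K′ = α ∫_Ω ( −∂_t((1/2)ρ|u|²) + K ⟨(1/2)(∂_t ρ) u + ρ ∂_t u, u⟩ ) dx; T′ = α T ( ∫_Ω p ∇·u dx + β ∫_Ω ⟨∇(ν ∇·u), ∇p⟩ dx ). Then the modified energy E_M(t) = ∫_Ω ( (1/2)ρ|u|² + (λε/2)|∇φ|² + (λ/ε)F(φ) ) dx + (1/α)(r + Q + R + T + K)(t) satisfies E_M′(t) = −∫_Ω M(φ)|∇μ|² dx − (1/2)∫_Ω ν |D(u)|² dx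 for all t. -/
open MeasureTheory

noncomputable section

lemma intOn_of_cont {d : ℕ} {Ω : Set (Fin d → ℝ)} (hb : Bornology.IsBounded Ω)
    {g : (Fin d → ℝ) → ℝ} (hg : Continuous g) : Integrable g (volume.restrict Ω) := by
  have h1 : IntegrableOn g (closure Ω) :=
    hg.continuousOn.integrableOn_compact hb.isCompact_closure
  exact h1.mono_set subset_closure

lemma ibp {d : ℕ} {Ω Kc : Set (Fin d → ℝ)} (hK : IsCompact Kc) (hKΩ : Kc ⊆ Ω)
    {f g : (Fin d → ℝ) → ℝ} (hf : ContDiff ℝ (⊤ : ℕ∞) f) (hg : ContDiff ℝ (⊤ : ℕ∞) g)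
    (h0 : ∀ x, x ∉ Kc → g x = 0) (v : Fin d → ℝ) :
    ∫ x in Ω, fderiv ℝ f x v * g x = - ∫ x in Ω, f x * fderiv ℝ g x v := by
  have hsupp : tsupport g ⊆ Kc := by
    apply closure_minimal _ hK.isClosed
    intro x hx
    by_contra h
    exact hx (h0 x h)
  have hcs : HasCompactSupport g := hK.of_isClosed_subset (isClosed_tsupport g) hsupp
  have h1 : ∀ x, x ∉ Kc → fderiv ℝ g x = 0 := by
    intro x hx
    have : x ∉ tsupport g := fun h => hx (hsupp h)
    have h2 : x ∉ tsupport (fderiv ℝ g) := fun h => this (tsupport_fderiv_subset ℝ h)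
    exact image_eq_zero_of_notMem_tsupport h2
  have cf' : Continuous (fun x => fderiv ℝ f x v) :=
    (hf.continuous_fderiv (by simp)).clm_apply continuous_const
  have cg' : Continuous (fun x => fderiv ℝ g x v) :=
    (hg.continuous_fderiv (by simp)).clm_apply continuous_const
  rw [setIntegral_eq_integral_of_forall_compl_eq_zero
      (fun x hx => by rw [h0 x (fun h => hx (hKΩ h))]; simp),
    setIntegral_eq_integral_of_forall_compl_eq_zero
      (fun x hx => by rw [h1 x (fun h => hx (hKΩ h))]; simp)]
  rw [integral_mul_fderiv_eq_neg_fderiv_mul_of_integrable, neg_neg]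
  · exact (cf'.mul hg.continuous).integrable_of_hasCompactSupport hcs.mul_left
  · refine (hf.continuous.mul cg').integrable_of_hasCompactSupport
      (HasCompactSupport.mul_left ?_)
    exact hcs.fderiv_apply ℝ v
  · exact (hf.continuous.mul hg.continuous).integrable_of_hasCompactSupport hcs.mul_left
  · intro x _
    exact hf.contDiffAt.differentiableAt (by simp)
  · intro x _
    exact hg.contDiffAt.differentiableAt (by simp)

lemma smooth_pd {E : Type*} [NormedAddCommGroup E] [NormedSpace ℝ E] {f : E → ℝ}
    (hf : ContDiff ℝ (⊤ : ℕ∞) f) (v : E) :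
    ContDiff ℝ (⊤ : ℕ∞) (fun x => fderiv ℝ f x v) :=
  (hf.fderiv_right (m := (⊤ : ℕ∞)) (by simp)).clm_apply contDiff_const

lemma ibp_vdiv {d : ℕ} {Ω Kc : Set (Fin d → ℝ)} (hb : Bornology.IsBounded Ω)
    (hK : IsCompact Kc) (hKΩ : Kc ⊆ Ω)
    {w : (Fin d → ℝ) → (Fin d → ℝ)} {g : (Fin d → ℝ) → ℝ}
    (hw : ∀ i, ContDiff ℝ (⊤ : ℕ∞) (fun y => w y i)) (hg : ContDiff ℝ (⊤ : ℕ∞) g)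
    (h0 : ∀ x, x ∉ Kc → g x = 0) :
    ∫ x in Ω, vdiv w x * g x = - ∫ x in Ω, dot (w x) (grad g x) := by
  unfold vdiv dot grad
  simp only [Finset.sum_mul]
  rw [integral_finsetSum, integral_finsetSum, ← Finset.sum_neg_distrib]
  · exact Finset.sum_congr rfl fun i _ => ibp hK hKΩ (hw i) hg h0 _
  · intro i _
    exact intOn_of_cont hb ((hw i).continuous.mul (smooth_pd hg _).continuous)
  · intro i _
    exact intOn_of_cont hb ((smooth_pd (hw i) _).continuous.mul hg.continuous)

section timeDep
variable {d : ℕ} {g : ℝ → (Fin d → ℝ) → ℝ}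

lemma hasDerivAt_time (hg : ContDiff ℝ (⊤ : ℕ∞) (fun q : ℝ × (Fin d → ℝ) => g q.1 q.2))
    (t : ℝ) (x : Fin d → ℝ) : HasDerivAt (fun σ => g σ x)
      (fderiv ℝ (fun q : ℝ × (Fin d → ℝ) => g q.1 q.2) (t, x) (1, 0)) t := by
  have h1 := (hg.contDiffAt (x := (t, x))).differentiableAt (by simp) |>.hasFDerivAt
  have h2 : HasDerivAt (fun σ : ℝ => (σ, x)) ((1 : ℝ), (0 : Fin d → ℝ)) t :=
    (hasDerivAt_id t).prodMk (hasDerivAt_const t x)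
  exact h1.comp_hasDerivAt t h2

lemma hasFDerivAt_space (hg : ContDiff ℝ (⊤ : ℕ∞) (fun q : ℝ × (Fin d → ℝ) => g q.1 q.2))
    (t : ℝ) (x v : Fin d → ℝ) : fderiv ℝ (g t) x v =
      fderiv ℝ (fun q : ℝ × (Fin d → ℝ) => g q.1 q.2) (t, x) (0, v) := by
  have h1 := (hg.contDiffAt (x := (t, x))).differentiableAt (by simp) |>.hasFDerivAt
  have h3 : HasFDerivAt (g t) _ x := h1.comp x (hasFDerivAt_prodMk_right t x)
  rw [h3.fderiv]
  simp

lemma smooth_time (hg : ContDiff ℝ (⊤ : ℕ∞) (fun q : ℝ × (Fin d → ℝ) => g q.1 q.2)) :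
    ContDiff ℝ (⊤ : ℕ∞) (fun q : ℝ × (Fin d → ℝ) => deriv (fun σ => g σ q.2) q.1) := by
  have := smooth_pd hg ((1 : ℝ), (0 : Fin d → ℝ))
  convert this using 2 with q
  exact (hasDerivAt_time hg q.1 q.2).deriv

lemma smooth_space (hg : ContDiff ℝ (⊤ : ℕ∞) (fun q : ℝ × (Fin d → ℝ) => g q.1 q.2))
    (v : Fin d → ℝ) :
    ContDiff ℝ (⊤ : ℕ∞) (fun q : ℝ × (Fin d → ℝ) => fderiv ℝ (g q.1) q.2 v) := by
  have := smooth_pd hg ((0 : ℝ), v)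
  convert this using 2 with q
  exact hasFDerivAt_space hg q.1 q.2 v

lemma smooth_slice (hg : ContDiff ℝ (⊤ : ℕ∞) (fun q : ℝ × (Fin d → ℝ) => g q.1 q.2))
    (t : ℝ) : ContDiff ℝ (⊤ : ℕ∞) (g t) := by
  have : ContDiff ℝ (⊤ : ℕ∞) (fun x : Fin d → ℝ => (t, x)) :=
    contDiff_const.prodMk contDiff_id
  exact hg.comp this

lemma swap_deriv (hg : ContDiff ℝ (⊤ : ℕ∞) (fun q : ℝ × (Fin d → ℝ) => g q.1 q.2))
    (t : ℝ) (x v : Fin d → ℝ) :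
    deriv (fun σ => fderiv ℝ (g σ) x v) t =
      fderiv ℝ (fun y => deriv (fun σ => g σ y) t) x v := by
  rw [(hasDerivAt_time (g := fun σ y => fderiv ℝ (g σ) y v) (smooth_space hg v) t x).deriv,
    hasFDerivAt_space (g := fun τ y => deriv (fun σ => g σ y) τ) (smooth_time hg) t x v]
  have e1 : (fun q : ℝ × (Fin d → ℝ) => fderiv ℝ (g q.1) q.2 v) =
      fun q => fderiv ℝ (fun q : ℝ × (Fin d → ℝ) => g q.1 q.2) q (0, v) :=
    funext fun q => hasFDerivAt_space hg q.1 q.2 v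
  have e2 : (fun q : ℝ × (Fin d → ℝ) => deriv (fun σ => g σ q.2) q.1) =
      fun q => fderiv ℝ (fun q : ℝ × (Fin d → ℝ) => g q.1 q.2) q (1, 0) :=
    funext fun q => (hasDerivAt_time hg q.1 q.2).deriv
  rw [e1, e2]
  have hd : DifferentiableAt ℝ (fderiv ℝ (fun q : ℝ × (Fin d → ℝ) => g q.1 q.2)) (t, x) :=
    ((hg.fderiv_right (m := (⊤ : ℕ∞)) (by simp)).contDiffAt).differentiableAt (by simp)
  have hs : IsSymmSndFDerivAt ℝ (fun q : ℝ × (Fin d → ℝ) => g q.1 q.2) (t, x) :=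
    hg.contDiffAt.isSymmSndFDerivAt (by
      simp only [minSmoothness_of_isRCLikeNormedField]
      exact WithTop.coe_le_coe.2 (le_top : (2 : ℕ∞) ≤ ⊤))
  rw [fderiv_clm_apply hd (by fun_prop), fderiv_clm_apply hd (by fun_prop)]
  simp
  exact hs _ _

lemma hasDerivAt_int {Ω : Set (Fin d → ℝ)} (hb : Bornology.IsBounded Ω) (hΩo : IsOpen Ω)
    (hg : ContDiff ℝ (⊤ : ℕ∞) (fun q : ℝ × (Fin d → ℝ) => g q.1 q.2)) (t : ℝ) :
    HasDerivAt (fun σ => ∫ x in Ω, g σ x) (∫ x in Ω, deriv (fun σ => g σ x) t) t := by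
  have hc := (smooth_time hg).continuous
  have hcomp : IsCompact (Metric.closedBall t 1 ×ˢ closure Ω) :=
    (isCompact_closedBall t 1).prod hb.isCompact_closure
  obtain ⟨C, hC⟩ := hcomp.exists_bound_of_continuousOn hc.continuousOn
  refine (hasDerivAt_integral_of_dominated_loc_of_deriv_le
    (F' := fun τ x => deriv (fun σ => g σ x) τ) (bound := fun _ => C)
    (Metric.closedBall_mem_nhds t one_pos) ?_ ?_ ?_ ?_ ?_ ?_).2
  · exact Filter.Eventually.of_forall fun σ =>
      (smooth_slice hg σ).continuous.aestronglyMeasurable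
  · exact intOn_of_cont hb (smooth_slice hg t).continuous
  · exact (smooth_slice (g := fun τ y => deriv (fun σ => g σ y) τ)
      (smooth_time hg) t).continuous.aestronglyMeasurable
  · refine (ae_restrict_iff' hΩo.measurableSet).2 (Filter.Eventually.of_forall ?_)
    intro x hx τ hτ
    exact hC (τ, x) ⟨hτ, subset_closure hx⟩
  · exact intOn_of_cont hb continuous_const
  · refine Filter.Eventually.of_forall fun x τ _ => ?_
    have := hasDerivAt_time hg τ x
    rwa [← this.deriv] at this

end timeDep

lemma cont_dot {X : Type*} [TopologicalSpace X] {d : ℕ} {v w : X → (Fin d → ℝ)}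
    (hv : Continuous v) (hw : Continuous w) : Continuous (fun x => dot (v x) (w x)) := by
  unfold dot
  fun_prop

lemma smooth_dot {X : Type*} [NormedAddCommGroup X] [NormedSpace ℝ X] {d : ℕ}
    {v w : X → (Fin d → ℝ)} (hv : ContDiff ℝ (⊤ : ℕ∞) v) (hw : ContDiff ℝ (⊤ : ℕ∞) w) :
    ContDiff ℝ (⊤ : ℕ∞) (fun x => dot (v x) (w x)) := by
  unfold dot
  rw [contDiff_pi] at hv hw
  exact ContDiff.sum fun i _ => (hv i).mul (hw i)

lemma smooth_grad {d : ℕ} {f : (Fin d → ℝ) → ℝ} (hf : ContDiff ℝ (⊤ : ℕ∞) f) :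
    ContDiff ℝ (⊤ : ℕ∞) (grad f) :=
  contDiff_pi.2 fun _ => smooth_pd hf _

lemma smooth_vdiv {d : ℕ} {v : (Fin d → ℝ) → (Fin d → ℝ)} (hv : ContDiff ℝ (⊤ : ℕ∞) v) :
    ContDiff ℝ (⊤ : ℕ∞) (vdiv v) := by
  rw [contDiff_pi] at hv
  exact ContDiff.sum fun i _ => smooth_pd (hv i) _

lemma smooth_dirD {d : ℕ} {v w : (Fin d → ℝ) → (Fin d → ℝ)} (hv : ContDiff ℝ (⊤ : ℕ∞) v)
    (hw : ContDiff ℝ (⊤ : ℕ∞) w) : ContDiff ℝ (⊤ : ℕ∞) (dirD v w) := by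
  rw [contDiff_pi] at hw
  exact contDiff_pi.2 fun i =>
    ((hw i).fderiv_right (m := (⊤ : ℕ∞)) (by simp)).clm_apply hv

lemma smooth_strain {d : ℕ} {v : (Fin d → ℝ) → (Fin d → ℝ)} (hv : ContDiff ℝ (⊤ : ℕ∞) v)
    (i j : Fin d) : ContDiff ℝ (⊤ : ℕ∞) (fun x => strain v x i j) := by
  rw [contDiff_pi] at hv
  exact (smooth_pd (hv i) _).add (smooth_pd (hv j) _)

lemma smooth_divStrain {d : ℕ} {n : (Fin d → ℝ) → ℝ} {v : (Fin d → ℝ) → (Fin d → ℝ)}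
    (hn : ContDiff ℝ (⊤ : ℕ∞) n) (hv : ContDiff ℝ (⊤ : ℕ∞) v) :
    ContDiff ℝ (⊤ : ℕ∞) (divStrain n v) :=
  contDiff_pi.2 fun i => ContDiff.sum fun j _ => smooth_pd (hn.mul (smooth_strain hv i j)) _

/-- Korn-type identity: `∫ ⟨∇·(n D(v)), v⟩ = -(1/2) ∫ n |D(v)|²`. -/
lemma visc {d : ℕ} {Ω Kc : Set (Fin d → ℝ)} (hb : Bornology.IsBounded Ω)
    (hK : IsCompact Kc) (hKΩ : Kc ⊆ Ω) {n : (Fin d → ℝ) → ℝ} {v : (Fin d → ℝ) → (Fin d → ℝ)}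
    (hn : ContDiff ℝ (⊤ : ℕ∞) n) (hv : ContDiff ℝ (⊤ : ℕ∞) v)
    (h0 : ∀ x, x ∉ Kc → v x = 0) :
    ∫ x in Ω, dot (divStrain n v x) (v x) = -((1 / 2) * ∫ x in Ω, n x * strainSq v x) := by
  have hv' := contDiff_pi.1 hv
  have e : ∀ i, ∫ x in Ω, divStrain n v x i * v x i =
      - ∫ x in Ω, dot (fun j => n x * strain v x i j) (grad (fun y => v y i) x) := fun i =>
    ibp_vdiv hb hK hKΩ (w := fun x j => n x * strain v x i j)
      (fun j => hn.mul (smooth_strain hv i j)) (hv' i) (fun x hx => by simp [h0 x hx])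
  have l : ∫ x in Ω, dot (divStrain n v x) (v x) =
      ∑ i, ∫ x in Ω, divStrain n v x i * v x i := by
    unfold dot
    rw [integral_finsetSum]
    intro i _
    exact intOn_of_cont hb
      ((contDiff_pi.1 (smooth_divStrain hn hv) i).continuous.mul (hv' i).continuous)
  rw [l, Finset.sum_congr rfl fun i _ => e i, Finset.sum_neg_distrib, ← integral_finsetSum,
    ← integral_const_mul]
  · congr 2
    funext x
    unfold dot grad strainSq
    have h2 : ∑ i, ∑ j, n x * strain v x i j * fderiv ℝ (fun y => v y i) x (Pi.single j 1) =
        ∑ i, ∑ j, n x * strain v x i j * fderiv ℝ (fun y => v y j) x (Pi.single i 1) := by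
      rw [Finset.sum_comm]
      refine Finset.sum_congr rfl fun i _ => Finset.sum_congr rfl fun j _ => ?_
      unfold strain
      ring
    have h3 : n x * ∑ i, ∑ j, strain v x i j ^ 2 =
        ∑ i, ∑ j, n x * strain v x i j * fderiv ℝ (fun y => v y i) x (Pi.single j 1) +
        ∑ i, ∑ j, n x * strain v x i j * fderiv ℝ (fun y => v y j) x (Pi.single i 1) := by
      simp only [Finset.mul_sum, ← Finset.sum_add_distrib]
      refine Finset.sum_congr rfl fun i _ => Finset.sum_congr rfl fun j _ => ?_
      unfold strain
      ring
    linarith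
  · intro i _
    refine intOn_of_cont hb (smooth_dot (contDiff_pi.2 fun j => ?_) (smooth_grad (hv' i))).continuous
    exact hn.mul (smooth_strain hv i j)

section lin
variable {X : Type*} [MeasurableSpace X] {m : Measure X} {f g h k : X → ℝ}

lemma int_lin4 (hf : Integrable f m) (hg : Integrable g m) (hh : Integrable h m)
    (hk : Integrable k m) (a b c e : ℝ) :
    ∫ x, (a * f x + b * g x + c * h x + e * k x) ∂m =
      a * ∫ x, f x ∂m + b * ∫ x, g x ∂m + c * ∫ x, h x ∂m + e * ∫ x, k x ∂m := by
  have h1 : Integrable (fun x => a * f x + b * g x) m := (hf.const_mul a).add (hg.const_mul b)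
  have h2 : Integrable (fun x => a * f x + b * g x + c * h x) m := h1.add (hh.const_mul c)
  rw [integral_add h2 (hk.const_mul e), integral_add h1 (hh.const_mul c),
    integral_add (hf.const_mul a) (hg.const_mul b)]
  simp only [integral_const_mul]

lemma int_neg_add (hf : Integrable f m) (hg : Integrable g m) (b : ℝ) :
    ∫ x, (-f x + b * g x) ∂m = -∫ x, f x ∂m + b * ∫ x, g x ∂m := by
  rw [integral_add (f := fun x => -f x) hf.neg (hg.const_mul b), integral_neg,
    integral_const_mul]

lemma int_add3 (hf : Integrable f m) (hg : Integrable g m) (hh : Integrable h m) :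
    ∫ x, (f x + g x + h x) ∂m = ∫ x, f x ∂m + ∫ x, g x ∂m + ∫ x, h x ∂m := by
  have h1 : Integrable (fun x => f x + g x) m := hf.add hg
  rw [integral_add h1 hh, integral_add hf hg]

end lin

theorem stmt5 {d : ℕ} (hd : 1 ≤ d) (Ω : Set (Fin d → ℝ)) (hΩo : IsOpen Ω)
    (hΩb : Bornology.IsBounded Ω)
    (ρ₁ ρ₂ ν₁ ν₂ lam ε α : ℝ)
    (hρ₁ : 0 < ρ₁) (hρ₂ : 0 < ρ₂) (hν₁ : 0 < ν₁) (hν₂ : 0 < ν₂)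
    (hlam : 0 < lam) (hε : 0 < ε) (hα : 0 < α) (s β χ : ℝ)
    (M : ℝ → ℝ) (hM : ContDiff ℝ (⊤ : ℕ∞) M)
    (φ μ p : ℝ → (Fin d → ℝ) → ℝ) (u : ℝ → (Fin d → ℝ) → (Fin d → ℝ))
    (hφ : ContDiff ℝ (⊤ : ℕ∞) (fun q : ℝ × (Fin d → ℝ) => φ q.1 q.2))
    (hμ : ContDiff ℝ (⊤ : ℕ∞) (fun q : ℝ × (Fin d → ℝ) => μ q.1 q.2))
    (hp : ContDiff ℝ (⊤ : ℕ∞) (fun q : ℝ × (Fin d → ℝ) => p q.1 q.2))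
    (hu : ContDiff ℝ (⊤ : ℕ∞) (fun q : ℝ × (Fin d → ℝ) => u q.1 q.2))
    (Kc : Set (Fin d → ℝ)) (hKc : IsCompact Kc) (hKΩ : Kc ⊆ Ω)
    (hφsupp : ∀ t, tsupport (φ t) ⊆ Kc) (hμsupp : ∀ t, tsupport (μ t) ⊆ Kc)
    (hpsupp : ∀ t, tsupport (p t) ⊆ Kc) (husupp : ∀ t, tsupport (u t) ⊆ Kc)
    (r Q R T Kv : ℝ → ℝ)
    (hr : Differentiable ℝ r) (hQ : Differentiable ℝ Q) (hR : Differentiable ℝ R)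
    (hT : Differentiable ℝ T) (hKv : Differentiable ℝ Kv)
    -- the modified Cahn–Hilliard equation
    (hCH : ∀ t x, deriv (fun σ => φ σ x) t +
        Q t * vdiv (fun y i => φ t y * u t y i) x =
      vdiv (fun y i => M (φ t y) * grad (μ t) y i) x)
    -- the chemical potential equation
    (hchem : ∀ t x, μ t x = lam * (-(ε * lap (φ t) x) + (s / ε) * φ t x +
      (r t / ε) * (((φ t x) ^ 3 - φ t x) - s * φ t x)))
    -- the modified momentum equation
    (hmom : ∀ t x (i : Fin d),
      Kv t * (((φ t x) / 2 * (ρ₁ - ρ₂) + (ρ₁ + ρ₂) / 2) * deriv (fun σ => u σ x i) t +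
          (1 / 2) * deriv (fun σ => (φ σ x) / 2 * (ρ₁ - ρ₂) + (ρ₁ + ρ₂) / 2) t * u t x i) -
        divStrain (fun y => (φ t y) / 2 * (ν₁ - ν₂) + (ν₁ + ν₂) / 2) (u t) x i +
        R t * grad (p t) x i +
        Q t * φ t x * grad (μ t) x i +
        R t * ((φ t x) / 2 * (ρ₁ - ρ₂) + (ρ₁ + ρ₂) / 2) * dirD (u t) (u t) x i +
        (1 / 2) * R t *
          vdiv (fun y j => ((φ t y) / 2 * (ρ₁ - ρ₂) + (ρ₁ + ρ₂) / 2) * u t y j) x * u t x i +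
        R t * dirD (fun y j => M (φ t y) * grad (μ t) y j * ((ρ₂ - ρ₁) / 2)) (u t) x i +
        (1 / 2) * R t *
          vdiv (fun y j => M (φ t y) * grad (μ t) y j * ((ρ₂ - ρ₁) / 2)) x * u t x i = 0)
    -- incompressibility
    (hdivfree : ∀ t x, vdiv (u t) x = 0)
    -- the ODE for r
    (hrode : ∀ t, deriv r t = α *
      (-deriv (fun σ => (lam / ε) *
          ∫ x in Ω, ((1 / 4) * ((φ σ x) ^ 2 - 1) ^ 2 - (s / 2) * (φ σ x) ^ 2)) t +
        (r t * lam / ε) *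
          ∫ x in Ω, (((φ t x) ^ 3 - φ t x) - s * φ t x) * deriv (fun σ => φ σ x) t))
    -- the ODE for Q
    (hQode : ∀ t, deriv Q t = α * Q t *
      ∫ x in Ω, (vdiv (fun y i => φ t y * u t y i) x * μ t x +
        φ t x * dot (grad (μ t) x) (u t x)))
    -- the ODE for R
    (hRode : ∀ t, deriv R t = α * R t *
      ∫ x in Ω, (((φ t x) / 2 * (ρ₁ - ρ₂) + (ρ₁ + ρ₂) / 2) * dot (dirD (u t) (u t) x) (u t x) +
        (1 / 2) * vdiv (fun y j => ((φ t y) / 2 * (ρ₁ - ρ₂) + (ρ₁ + ρ₂) / 2) * u t y j) x *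
          dot (u t x) (u t x) +
        dot (dirD (fun y j => M (φ t y) * grad (μ t) y j * ((ρ₂ - ρ₁) / 2)) (u t) x) (u t x) +
        (1 / 2) * vdiv (fun y j => M (φ t y) * grad (μ t) y j * ((ρ₂ - ρ₁) / 2)) x *
          dot (u t x) (u t x) +
        dot (grad (p t) x) (u t x)))
    -- the ODE for K
    (hKode : ∀ t, deriv Kv t = α *
      ∫ x in Ω,
        (-deriv (fun σ => (1 / 2) * ((φ σ x) / 2 * (ρ₁ - ρ₂) + (ρ₁ + ρ₂) / 2) *
            dot (u σ x) (u σ x)) t +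
          Kv t * dot (fun i =>
            (1 / 2) * deriv (fun σ => (φ σ x) / 2 * (ρ₁ - ρ₂) + (ρ₁ + ρ₂) / 2) t * u t x i +
              ((φ t x) / 2 * (ρ₁ - ρ₂) + (ρ₁ + ρ₂) / 2) * deriv (fun σ => u σ x i) t)
            (u t x)))
    -- the ODE for T
    (hTode : ∀ t, deriv T t = α * T t *
      ((∫ x in Ω, p t x * vdiv (u t) x) +
        β * ∫ x in Ω,
          dot (grad (fun y => ((φ t y) / 2 * (ν₁ - ν₂) + (ν₁ + ν₂) / 2) * vdiv (u t) y) x)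
            (grad (p t) x))) :
    ∀ t, HasDerivAt
      (fun σ => (∫ x in Ω,
        ((1 / 2) * ((φ σ x) / 2 * (ρ₁ - ρ₂) + (ρ₁ + ρ₂) / 2) * dot (u σ x) (u σ x) +
          lam * ε / 2 * dot (grad (φ σ) x) (grad (φ σ) x) +
          lam / ε * ((1 / 4) * ((φ σ x) ^ 2 - 1) ^ 2))) +
        (1 / α) * (r σ + Q σ + R σ + T σ + Kv σ))
      (-(∫ x in Ω, M (φ t x) * dot (grad (μ t) x) (grad (μ t) x)) -
        (1 / 2) * ∫ x in Ω, ((φ t x) / 2 * (ν₁ - ν₂) + (ν₁ + ν₂) / 2) * strainSq (u t) x) t := by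
  intro t
  -- smoothness of the slices
  have sφ := smooth_slice hφ t
  have sμ := smooth_slice hμ t
  have sp := smooth_slice hp t
  have hui : ∀ i, ContDiff ℝ (⊤ : ℕ∞) (fun q : ℝ × (Fin d → ℝ) => u q.1 q.2 i) :=
    contDiff_pi.1 hu
  have su : ContDiff ℝ (⊤ : ℕ∞) (u t) :=
    contDiff_pi.2 fun i => smooth_slice (g := fun σ x => u σ x i) (hui i) t
  have sui := contDiff_pi.1 su
  have sφt : ContDiff ℝ (⊤ : ℕ∞) (fun x => deriv (fun σ => φ σ x) t) :=
    smooth_slice (g := fun τ y => deriv (fun σ => φ σ y) τ) (smooth_time hφ) t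
  have hρ : ContDiff ℝ (⊤ : ℕ∞)
      (fun q : ℝ × (Fin d → ℝ) => (φ q.1 q.2) / 2 * (ρ₁ - ρ₂) + (ρ₁ + ρ₂) / 2) := by
    fun_prop
  have sρ : ContDiff ℝ (⊤ : ℕ∞)
      (fun x => (φ t x) / 2 * (ρ₁ - ρ₂) + (ρ₁ + ρ₂) / 2) := by fun_prop
  have sν : ContDiff ℝ (⊤ : ℕ∞)
      (fun x => (φ t x) / 2 * (ν₁ - ν₂) + (ν₁ + ν₂) / 2) := by fun_prop
  have sρt : ContDiff ℝ (⊤ : ℕ∞)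
      (fun x => deriv (fun σ => (φ σ x) / 2 * (ρ₁ - ρ₂) + (ρ₁ + ρ₂) / 2) t) :=
    smooth_slice (g := fun τ y => deriv (fun σ => (φ σ y) / 2 * (ρ₁ - ρ₂) + (ρ₁ + ρ₂) / 2) τ)
      (smooth_time (g := fun σ y => (φ σ y) / 2 * (ρ₁ - ρ₂) + (ρ₁ + ρ₂) / 2) hρ) t
  have suit : ∀ i, ContDiff ℝ (⊤ : ℕ∞) (fun x => deriv (fun σ => u σ x i) t) := fun i =>
    smooth_slice (g := fun τ y => deriv (fun σ => u σ y i) τ)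
      (smooth_time (g := fun σ x => u σ x i) (hui i)) t
  have sMφ : ContDiff ℝ (⊤ : ℕ∞) (fun x => M (φ t x)) := hM.comp sφ
  have sgμ := smooth_grad sμ
  have sgμi := contDiff_pi.1 sgμ
  have sMg : ContDiff ℝ (⊤ : ℕ∞) (fun y i => M (φ t y) * grad (μ t) y i) :=
    contDiff_pi.2 fun i => sMφ.mul (sgμi i)
  have sJ : ContDiff ℝ (⊤ : ℕ∞) (fun y i => M (φ t y) * grad (μ t) y i * ((ρ₂ - ρ₁) / 2)) :=
    contDiff_pi.2 fun i => (sMφ.mul (sgμi i)).mul contDiff_const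
  have sφu : ContDiff ℝ (⊤ : ℕ∞) (fun y i => φ t y * u t y i) :=
    contDiff_pi.2 fun i => sφ.mul (sui i)
  have sρu : ContDiff ℝ (⊤ : ℕ∞)
      (fun y i => ((φ t y) / 2 * (ρ₁ - ρ₂) + (ρ₁ + ρ₂) / 2) * u t y i) :=
    contDiff_pi.2 fun i => sρ.mul (sui i)
  -- vanishing outside `Kc`
  have zφ : ∀ σ x, x ∉ Kc → φ σ x = 0 := fun σ x hx =>
    image_eq_zero_of_notMem_tsupport fun h => hx (hφsupp σ h)
  have zμ : ∀ x, x ∉ Kc → μ t x = 0 := fun x hx =>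
    image_eq_zero_of_notMem_tsupport fun h => hx (hμsupp t h)
  have zu : ∀ x, x ∉ Kc → u t x = 0 := fun x hx =>
    image_eq_zero_of_notMem_tsupport fun h => hx (husupp t h)
  have zφt : ∀ x, x ∉ Kc → deriv (fun σ => φ σ x) t = 0 := fun x hx => by
    simp [zφ _ x hx]
  -- energy terms as smooth space-time functions
  have hkin : ContDiff ℝ (⊤ : ℕ∞) (fun q : ℝ × (Fin d → ℝ) =>
      (1 / 2) * ((φ q.1 q.2) / 2 * (ρ₁ - ρ₂) + (ρ₁ + ρ₂) / 2) *
        dot (u q.1 q.2) (u q.1 q.2)) :=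
    (contDiff_const.mul hρ).mul (smooth_dot hu hu)
  have hgφi : ∀ i, ContDiff ℝ (⊤ : ℕ∞) (fun q : ℝ × (Fin d → ℝ) => grad (φ q.1) q.2 i) :=
    fun i => smooth_space hφ _
  have hgr : ContDiff ℝ (⊤ : ℕ∞) (fun q : ℝ × (Fin d → ℝ) =>
      lam * ε / 2 * dot (grad (φ q.1) q.2) (grad (φ q.1) q.2)) :=
    contDiff_const.mul (smooth_dot (contDiff_pi.2 hgφi) (contDiff_pi.2 hgφi))
  have hpot : ContDiff ℝ (⊤ : ℕ∞) (fun q : ℝ × (Fin d → ℝ) =>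
      lam / ε * ((1 / 4) * ((φ q.1 q.2) ^ 2 - 1) ^ 2)) := by fun_prop
  have hE0 : ContDiff ℝ (⊤ : ℕ∞) (fun q : ℝ × (Fin d → ℝ) =>
      (1 / 4) * ((φ q.1 q.2) ^ 2 - 1) ^ 2 - (s / 2) * (φ q.1 q.2) ^ 2) := by fun_prop
  have dφ : ∀ x, HasDerivAt (fun σ => φ σ x) (deriv (fun σ => φ σ x) t) t := fun x =>
    (hasDerivAt_time hφ t x).differentiableAt.hasDerivAt
  have dgφ : ∀ x i, HasDerivAt (fun σ => grad (φ σ) x i)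
      (grad (fun y => deriv (fun σ => φ σ y) t) x i) t := fun x i => by
    have h := (hasDerivAt_time (g := fun σ y => grad (φ σ) y i)
      (hgφi i) t x).differentiableAt.hasDerivAt
    rwa [show deriv (fun σ => grad (φ σ) x i) t = _ from swap_deriv hφ t x _] at h
  have dgr : ∀ x, deriv (fun σ => lam * ε / 2 * dot (grad (φ σ) x) (grad (φ σ) x)) t =
      lam * ε * dot (grad (φ t) x) (grad (fun y => deriv (fun σ => φ σ y) t) x) := fun x => by
    have h : HasDerivAt (fun σ => dot (grad (φ σ) x) (grad (φ σ) x)) _ t :=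
      HasDerivAt.fun_sum (u := Finset.univ) fun i _ => (dgφ x i).mul (dgφ x i)
    rw [(h.const_mul (lam * ε / 2)).deriv]
    unfold dot
    simp only [Finset.mul_sum]
    refine Finset.sum_congr rfl fun i _ => ?_
    ring
  have dpot : ∀ x, deriv (fun σ => lam / ε * ((1 / 4) * ((φ σ x) ^ 2 - 1) ^ 2)) t =
      lam / ε * (((φ t x) ^ 3 - φ t x) * deriv (fun σ => φ σ x) t) := fun x => by
    have h := (((((dφ x).pow 2).sub_const 1).pow 2).const_mul (1 / 4)).const_mul (lam / ε)
    refine h.deriv.trans ?_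
    simp only [Pi.pow_apply]
    push_cast
    ring
  have dE0 : ∀ x, deriv (fun σ => (1 / 4) * ((φ σ x) ^ 2 - 1) ^ 2 - (s / 2) * (φ σ x) ^ 2) t =
      ((φ t x) ^ 3 - φ t x) * deriv (fun σ => φ σ x) t -
        s * (φ t x * deriv (fun σ => φ σ x) t) := fun x => by
    have h := (((((dφ x).pow 2).sub_const 1).pow 2).const_mul (1 / 4)).sub
      (((dφ x).pow 2).const_mul (s / 2))
    refine h.deriv.trans ?_
    simp
    ring
  have HK := hasDerivAt_int (g := fun σ x =>
    (1 / 2) * ((φ σ x) / 2 * (ρ₁ - ρ₂) + (ρ₁ + ρ₂) / 2) * dot (u σ x) (u σ x))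
    hΩb hΩo hkin t
  have HG := hasDerivAt_int (g := fun σ x =>
    lam * ε / 2 * dot (grad (φ σ) x) (grad (φ σ) x)) hΩb hΩo hgr t
  have HP := hasDerivAt_int (g := fun σ x =>
    lam / ε * ((1 / 4) * ((φ σ x) ^ 2 - 1) ^ 2)) hΩb hΩo hpot t
  have HE := (hasDerivAt_int (g := fun σ x =>
    (1 / 4) * ((φ σ x) ^ 2 - 1) ^ 2 - (s / 2) * (φ σ x) ^ 2) hΩb hΩo hE0 t).const_mul (lam / ε)
  simp only [dgr, integral_const_mul] at HG
  simp only [dpot, integral_const_mul] at HP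
  simp only [dE0] at HE
  -- integrability
  have iZ : Integrable (fun x => ((φ t x) ^ 3 - φ t x) * deriv (fun σ => φ σ x) t)
      (volume.restrict Ω) :=
    intOn_of_cont hΩb (by have := sφ.continuous; have := sφt.continuous; fun_prop)
  have iY : Integrable (fun x => φ t x * deriv (fun σ => φ σ x) t) (volume.restrict Ω) :=
    intOn_of_cont hΩb (sφ.mul sφt).continuous
  have iX : Integrable (fun x => lap (φ t) x * deriv (fun σ => φ σ x) t)
      (volume.restrict Ω) :=
    intOn_of_cont hΩb ((smooth_vdiv (smooth_grad sφ)).mul sφt).continuous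
  have iP : Integrable (fun x => vdiv (fun y i => φ t y * u t y i) x * μ t x)
      (volume.restrict Ω) := intOn_of_cont hΩb ((smooth_vdiv sφu).mul sμ).continuous
  have iN : Integrable (fun x => φ t x * dot (grad (μ t) x) (u t x))
      (volume.restrict Ω) := intOn_of_cont hΩb (sφ.mul (smooth_dot sgμ su)).continuous
  have iD : Integrable (fun x => vdiv (fun y i => M (φ t y) * grad (μ t) y i) x * μ t x)
      (volume.restrict Ω) := intOn_of_cont hΩb ((smooth_vdiv sMg).mul sμ).continuous
  have im : Integrable (fun x => μ t x * deriv (fun σ => φ σ x) t) (volume.restrict Ω) :=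
    intOn_of_cont hΩb (sμ.mul sφt).continuous
  have iA : Integrable (fun x => deriv (fun σ => (1 / 2) *
      ((φ σ x) / 2 * (ρ₁ - ρ₂) + (ρ₁ + ρ₂) / 2) * dot (u σ x) (u σ x)) t)
      (volume.restrict Ω) :=
    intOn_of_cont hΩb (smooth_slice (g := fun τ x => deriv (fun σ => (1 / 2) *
      ((φ σ x) / 2 * (ρ₁ - ρ₂) + (ρ₁ + ρ₂) / 2) * dot (u σ x) (u σ x)) τ)
      (smooth_time (g := fun σ x => (1 / 2) *
      ((φ σ x) / 2 * (ρ₁ - ρ₂) + (ρ₁ + ρ₂) / 2) * dot (u σ x) (u σ x)) hkin) t).continuous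
  have iB : Integrable (fun x => dot (fun i =>
            (1 / 2) * deriv (fun σ => (φ σ x) / 2 * (ρ₁ - ρ₂) + (ρ₁ + ρ₂) / 2) t * u t x i +
              ((φ t x) / 2 * (ρ₁ - ρ₂) + (ρ₁ + ρ₂) / 2) * deriv (fun σ => u σ x i) t)
            (u t x)) (volume.restrict Ω) :=
    intOn_of_cont hΩb (smooth_dot (contDiff_pi.2 fun i =>
      ((contDiff_const.mul sρt).mul (sui i)).add (sρ.mul (suit i))) su).continuous
  have iV : Integrable (fun x => dot
      (divStrain (fun y => (φ t y) / 2 * (ν₁ - ν₂) + (ν₁ + ν₂) / 2) (u t) x) (u t x))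
      (volume.restrict Ω) :=
    intOn_of_cont hΩb (smooth_dot (smooth_divStrain sν su) su).continuous
  have iW : Integrable (fun x =>
      ((φ t x) / 2 * (ρ₁ - ρ₂) + (ρ₁ + ρ₂) / 2) * dot (dirD (u t) (u t) x) (u t x) +
        (1 / 2) * vdiv (fun y j => ((φ t y) / 2 * (ρ₁ - ρ₂) + (ρ₁ + ρ₂) / 2) * u t y j) x *
          dot (u t x) (u t x) +
        dot (dirD (fun y j => M (φ t y) * grad (μ t) y j * ((ρ₂ - ρ₁) / 2)) (u t) x) (u t x) +
        (1 / 2) * vdiv (fun y j => M (φ t y) * grad (μ t) y j * ((ρ₂ - ρ₁) / 2)) x *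
          dot (u t x) (u t x) +
        dot (grad (p t) x) (u t x)) (volume.restrict Ω) :=
    intOn_of_cont hΩb (((((sρ.mul (smooth_dot (smooth_dirD su su) su)).add
      ((contDiff_const.mul (smooth_vdiv sρu)).mul (smooth_dot su su))).add
      (smooth_dot (smooth_dirD sJ su) su)).add
      ((contDiff_const.mul (smooth_vdiv sJ)).mul (smooth_dot su su))).add
      (smooth_dot (smooth_grad sp) su)).continuous
  -- integral identities
  have eG : ∫ x in Ω, lap (φ t) x * deriv (fun σ => φ σ x) t =
      -∫ x in Ω, dot (grad (φ t) x) (grad (fun y => deriv (fun σ => φ σ y) t) x) :=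
    ibp_vdiv hΩb hKc hKΩ (contDiff_pi.1 (smooth_grad sφ)) sφt zφt
  have eD : ∫ x in Ω, vdiv (fun y i => M (φ t y) * grad (μ t) y i) x * μ t x =
      -∫ x in Ω, M (φ t x) * dot (grad (μ t) x) (grad (μ t) x) := by
    rw [ibp_vdiv hΩb hKc hKΩ (contDiff_pi.1 sMg) sμ zμ]
    congr 2
    funext x
    simp only [dot, Finset.mul_sum, mul_assoc]
  have eV := visc hΩb hKc hKΩ sν su zu
  have em : ∫ x in Ω, μ t x * deriv (fun σ => φ σ x) t =
      -(lam * ε) * (∫ x in Ω, lap (φ t) x * deriv (fun σ => φ σ x) t) +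
      lam * (s / ε) * (∫ x in Ω, φ t x * deriv (fun σ => φ σ x) t) +
      lam * (r t / ε) * ((∫ x in Ω, ((φ t x) ^ 3 - φ t x) * deriv (fun σ => φ σ x) t) -
        s * ∫ x in Ω, φ t x * deriv (fun σ => φ σ x) t) := by
    have h4 := int_lin4 iX iY iZ iY (-(lam * ε)) (lam * (s / ε)) (lam * (r t / ε))
      (-(lam * (r t / ε) * s))
    refine Eq.trans ?_ (h4.trans (by ring))
    congr 1
    funext x
    rw [hchem t x]
    ring
  have eCH : (∫ x in Ω, μ t x * deriv (fun σ => φ σ x) t) +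
      Q t * (∫ x in Ω, vdiv (fun y i => φ t y * u t y i) x * μ t x) =
      ∫ x in Ω, vdiv (fun y i => M (φ t y) * grad (μ t) y i) x * μ t x := by
    rw [← integral_const_mul, ← integral_add im (iP.const_mul _)]
    congr 1
    funext x
    rw [← hCH t x]
    ring
  have eh : ∫ x in Ω, (((φ t x) ^ 3 - φ t x) - s * φ t x) * deriv (fun σ => φ σ x) t =
      (∫ x in Ω, ((φ t x) ^ 3 - φ t x) * deriv (fun σ => φ σ x) t) -
        s * ∫ x in Ω, φ t x * deriv (fun σ => φ σ x) t := by
    rw [← integral_const_mul, ← integral_sub iZ (iY.const_mul _)]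
    congr 1
    funext x
    ring
  have r1 := hrode t
  rw [HE.deriv, eh, integral_sub iZ (iY.const_mul _), integral_const_mul] at r1
  have q1 := hQode t
  rw [integral_add iP iN] at q1
  have k1 := hKode t
  rw [int_neg_add iA iB] at k1
  have w1 := hRode t
  have t1 : deriv T t = 0 := by
    rw [hTode t]
    simp [hdivfree, grad, dot]
  have emom := int_lin4 iB iV iW iN (Kv t) (-1) (R t) (Q t)
  have emom0 := emom.symm.trans ((integral_congr_ae (Filter.Eventually.of_forall fun x => by
    have h : ∑ i, _ * u t x i = ∑ i : Fin d, (0 : ℝ) * u t x i :=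
      Finset.sum_congr rfl fun i _ => congrArg (· * u t x i) (hmom t x i)
    simp only [zero_mul, Finset.sum_const_zero] at h
    refine Eq.trans ?_ h
    simp only [dot, Finset.mul_sum, ← Finset.sum_add_distrib]
    refine Finset.sum_congr rfl fun i _ => ?_
    ring)).trans (integral_zero _ _))
  have total := ((HK.add HG).add HP).add
    ((((((hr t).hasDerivAt.add (hQ t).hasDerivAt).add (hR t).hasDerivAt).add
      (hT t).hasDerivAt).add (hKv t).hasDerivAt).const_mul (1 / α))
  refine HasDerivAt.congr_of_eventuallyEq (total.congr_deriv (Eq.symm ?_)) (Filter.Eventually.of_forall ?_)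
  rotate_left
  · intro σ
    have jK := intOn_of_cont hΩb (smooth_slice (g := fun σ x =>
      (1 / 2) * ((φ σ x) / 2 * (ρ₁ - ρ₂) + (ρ₁ + ρ₂) / 2) * dot (u σ x) (u σ x))
      hkin σ).continuous
    have jG := intOn_of_cont hΩb (smooth_slice (g := fun σ x =>
      lam * ε / 2 * dot (grad (φ σ) x) (grad (φ σ) x)) hgr σ).continuous
    have jP := intOn_of_cont hΩb (smooth_slice (g := fun σ x =>
      lam / ε * ((1 / 4) * ((φ σ x) ^ 2 - 1) ^ 2)) hpot σ).continuous
    simp only [Pi.add_apply]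
    rw [int_add3 jK jG jP]
    simp only [integral_const_mul]
  · rw [r1, q1, k1, w1, t1]
    rw [eV] at emom0
    rw [eD] at eCH
    generalize (∫ x in Ω, M (φ t x) * dot (grad (μ t) x) (grad (μ t) x)) = ID at *
    have hα' : α ≠ 0 := hα.ne'
    have hc : ∀ a b c e : ℝ, 1 / α * (α * a + α * Q t * b + α * R t * c + 0 + α * e) =
        a + Q t * b + R t * c + e := fun a b c e => by field_simp; ring
    rw [hc]
    linear_combination -emom0 + em - eCH - lam * ε * eG
end
end
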